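/- Let P = ⟨-3+4y, x+1⟩ ⊆ ZQ₂₈ and N the sum of all 28 group elements. Then the ZQ₂₈-module P/NP is not isomorphic to ZQ₂₈/⟨N⟩, even though P/NP ⊕ ZQ₂₈ ≅ ZQ₂₈/⟨N⟩ ⊕ ZQ₂₈. -/

import Mathlib

open MonoidAlgebra

abbrev QR (n : ℕ) : Type := MonoidAlgebra ℤ (QuaternionGroup n)

noncomputable def Xq (n : ℕ) : QR n := of ℤ (QuaternionGroup n) (QuaternionGroup.a 1)
noncomputable def Yq (n : ℕ) : QR n := of ℤ (QuaternionGroup n) (QuaternionGroup.xa 0)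

/-- the left ideal `⟨-3+4y, x+1⟩` of `ℤQ₂₈` -/
noncomputable def P28 : Ideal (QR 7) :=
  Ideal.span {(-3 : QR 7) + (4 : QR 7) * Yq 7, Xq 7 + 1}

/-- the norm element: sum of all 28 group elements -/
noncomputable def Nelt : QR 7 := ∑ g : QuaternionGroup 7, of ℤ (QuaternionGroup 7) g

/-- `NP`, as a submodule of `P` -/
noncomputable def NP : Submodule (QR 7) P28 :=
  Submodule.comap P28.subtype
    (Submodule.span (QR 7) ((fun w => Nelt * w) '' (P28 : Set (QR 7))))

/-! ### Homomorphisms out of `ℤQ₂₈` -/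

section Lift

variable {S : Type*} [Ring S]

theorem pow_eq_pow_of_zmod_eq {X : S} (hX : X ^ 14 = 1) {m n : ℕ} (h : (m : ZMod 14) = n) :
    X ^ m = X ^ n := by
  rw [ZMod.natCast_eq_natCast_iff'] at h
  rw [pow_eq_pow_mod m hX, pow_eq_pow_mod n hX, h]

theorem pow_mul_eq_mul_pow {X Y : S} (hXY : X * Y = Y * X ^ 13) (k : ℕ) :
    X ^ k * Y = Y * X ^ (13 * k) := by
  have h : SemiconjBy Y (X ^ 13) X := hXY.symm
  rw [pow_mul]
  exact (h.pow_right k).eq.symm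

/-- The homomorphism out of `Q₂₈` attached to elements satisfying its defining relations. -/
def quaternionHom (X Y : S) (hX : X ^ 14 = 1) (hY : Y * Y = X ^ 7) (hXY : X * Y = Y * X ^ 13) :
    QuaternionGroup 7 →* S where
  toFun
    | .a i => X ^ (ZMod.val (n := 14) i)
    | .xa i => Y * X ^ (ZMod.val (n := 14) i)
  map_one' := by
    change X ^ (ZMod.val (n := 14) 0) = 1
    simp
  map_mul' := by
    rintro (i | i) (j | j)
    · change X ^ (ZMod.val (n := 14) (i + j)) =
        X ^ (ZMod.val (n := 14) i) * X ^ (ZMod.val (n := 14) j)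
      rw [← pow_add]
      exact pow_eq_pow_of_zmod_eq hX (by simp)
    · change Y * X ^ (ZMod.val (n := 14) (j - i)) =
        X ^ (ZMod.val (n := 14) i) * (Y * X ^ (ZMod.val (n := 14) j))
      rw [← mul_assoc, pow_mul_eq_mul_pow hXY, mul_assoc, ← pow_add]
      congr 1
      refine pow_eq_pow_of_zmod_eq hX ?_
      push_cast
      simp only [ZMod.natCast_val, ZMod.cast_id', id]
      rw [show (13 : ZMod 14) = -1 by decide]
      ring
    · change Y * X ^ (ZMod.val (n := 14) (i + j)) =
        Y * X ^ (ZMod.val (n := 14) i) * X ^ (ZMod.val (n := 14) j)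
      rw [mul_assoc, ← pow_add]
      congr 1
      exact pow_eq_pow_of_zmod_eq hX (by simp)
    · change X ^ (ZMod.val (n := 14) (((7 : ℕ) : ZMod 14) + j - i)) =
        Y * X ^ (ZMod.val (n := 14) i) * (Y * X ^ (ZMod.val (n := 14) j))
      rw [mul_assoc, ← mul_assoc (X ^ _) Y, pow_mul_eq_mul_pow hXY, mul_assoc, ← pow_add,
        ← mul_assoc, hY, ← pow_add]
      refine pow_eq_pow_of_zmod_eq hX ?_
      push_cast
      simp only [ZMod.natCast_val, ZMod.cast_id', id]
      rw [show (13 : ZMod 14) = -1 by decide]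
      ring

variable [Algebra ℤ S]

/-- The ring homomorphism out of `ℤQ₂₈` attached to elements satisfying the relations of `Q₂₈`. -/
noncomputable def quaternionRingHom (X Y : S) (hX : X ^ 14 = 1) (hY : Y * Y = X ^ 7)
    (hXY : X * Y = Y * X ^ 13) : QR 7 →ₐ[ℤ] S :=
  MonoidAlgebra.lift ℤ S (QuaternionGroup 7) (quaternionHom X Y hX hY hXY)

variable {X Y : S} (hX : X ^ 14 = 1) (hY : Y * Y = X ^ 7) (hXY : X * Y = Y * X ^ 13)

theorem quaternionRingHom_Xq : quaternionRingHom X Y hX hY hXY (Xq 7) = X := by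
  rw [quaternionRingHom, Xq, MonoidAlgebra.lift_of]
  change X ^ (ZMod.val (n := 14) 1) = X
  rw [show ZMod.val (n := 14) 1 = 1 from rfl, pow_one]

theorem quaternionRingHom_Yq : quaternionRingHom X Y hX hY hXY (Yq 7) = Y := by
  rw [quaternionRingHom, Yq, MonoidAlgebra.lift_of]
  change Y * X ^ (ZMod.val (n := 14) 0) = Y
  simp

end Lift

/-! ### The group ring `ℤQ₂₈` -/

theorem Xq_pow (k : ℕ) : Xq 7 ^ k = of ℤ (QuaternionGroup 7) (QuaternionGroup.a k) := by
  rw [Xq, ← map_pow, QuaternionGroup.a_one_pow]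

theorem Xq_pow_fourteen : Xq 7 ^ 14 = 1 := by
  rw [Xq_pow, ← map_one (of ℤ (QuaternionGroup 7))]
  rfl

theorem Yq_mul_Yq : Yq 7 * Yq 7 = Xq 7 ^ 7 := by
  rw [Xq_pow, Yq, ← map_mul]
  rfl

theorem Xq_mul_Yq_mul_Xq : Xq 7 * Yq 7 * Xq 7 = Yq 7 := by
  rw [Xq, Yq, ← map_mul, ← map_mul]
  rfl

theorem exists_aeval_Xq (w : QR 7) : ∃ A B : Polynomial ℤ,
    w = Polynomial.aeval (Xq 7) A + Yq 7 * Polynomial.aeval (Xq 7) B := by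
  induction w using MonoidAlgebra.induction_on with
  | of g =>
    rcases g with i | i
    · refine ⟨.X ^ (ZMod.val (n := 14) i), 0, ?_⟩
      rw [map_pow, Polynomial.aeval_X, Xq_pow]
      simp only [map_zero, mul_zero, add_zero]
      congr 2
      exact (ZMod.natCast_zmod_val (n := 14) i).symm
    · refine ⟨0, .X ^ (ZMod.val (n := 14) i), ?_⟩
      rw [map_pow, Polynomial.aeval_X, Xq_pow, Yq, ← map_mul, QuaternionGroup.xa_mul_a]
      simp only [map_zero, zero_add]
      congr 2
      exact (ZMod.natCast_zmod_val (n := 14) i).symm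
  | add v w hv hw =>
    obtain ⟨A, B, rfl⟩ := hv
    obtain ⟨A', B', rfl⟩ := hw
    refine ⟨A + A', B + B', ?_⟩
    simp only [map_add, mul_add]
    abel
  | smul n w hw =>
    obtain ⟨A, B, rfl⟩ := hw
    exact ⟨n • A, n • B, by simp only [map_smul, smul_add, mul_smul_comm]⟩

/-- The augmentation of `ℤQ₂₈`. -/
noncomputable def augQ : QR 7 →ₐ[ℤ] ℤ :=
  quaternionRingHom 1 1 (by simp) (by simp) (by simp)

theorem Nelt_mul_of (g : QuaternionGroup 7) : Nelt * of ℤ (QuaternionGroup 7) g = Nelt := by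
  rw [Nelt, Finset.sum_mul]
  simp_rw [← map_mul]
  exact Fintype.sum_equiv (Equiv.mulRight g) _ _ fun _ => rfl

theorem of_mul_Nelt (g : QuaternionGroup 7) : of ℤ (QuaternionGroup 7) g * Nelt = Nelt := by
  rw [Nelt, Finset.mul_sum]
  simp_rw [← map_mul]
  exact Fintype.sum_equiv (Equiv.mulLeft g) _ _ fun _ => rfl

theorem augQ_of (g : QuaternionGroup 7) : augQ (of ℤ (QuaternionGroup 7) g) = 1 := by
  rw [augQ, quaternionRingHom, MonoidAlgebra.lift_of]
  rcases g with i | i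
  · change (1 : ℤ) ^ _ = 1
    simp
  · change (1 : ℤ) * 1 ^ _ = 1
    simp

theorem Nelt_mul (w : QR 7) : Nelt * w = augQ w • Nelt := by
  induction w using MonoidAlgebra.induction_on with
  | of g => rw [Nelt_mul_of, augQ_of, one_smul]
  | add v w hv hw => rw [mul_add, hv, hw, map_add, add_smul]
  | smul n w hw => rw [mul_smul_comm, hw, map_smul, smul_smul, smul_eq_mul]

theorem mul_Nelt (w : QR 7) : w * Nelt = augQ w • Nelt := by
  induction w using MonoidAlgebra.induction_on with
  | of g => rw [of_mul_Nelt, augQ_of, one_smul]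
  | add v w hv hw => rw [add_mul, hv, hw, map_add, add_smul]
  | smul n w hw => rw [smul_mul_assoc, hw, map_smul, smul_smul, smul_eq_mul]

theorem Nelt_apply_one : Nelt.coeff 1 = 1 := by
  simp [Nelt, MonoidAlgebra.of_apply, MonoidAlgebra.coeff_single, Finsupp.single_apply]

theorem QR_smul_eq_zero {n : ℤ} (hn : n ≠ 0) {w : QR 7} (h : n • w = 0) : w = 0 := by
  ext g
  have h1 : n * w.coeff g = 0 := congrArg (fun v : QR 7 => v.coeff g) h
  exact (mul_eq_zero.mp h1).resolve_left hn

/-- A ring homomorphism to a domain that does not send `x` to `1` kills `N`. -/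
theorem map_Nelt_eq_zero {S : Type*} [Ring S] [Algebra ℤ S] [NoZeroDivisors S] (f : QR 7 →ₐ[ℤ] S)
    (h : f (Xq 7) ≠ 1) : f Nelt = 0 := by
  have h0 : Xq 7 * Nelt = Nelt := of_mul_Nelt _
  have h1 : (f (Xq 7) - 1) * f Nelt = 0 := by
    rw [sub_mul, ← map_mul, h0, one_mul, sub_self]
  exact (mul_eq_zero.mp h1).resolve_left (sub_ne_zero.mpr h)

/-! ### Representations of `ℤQ₂₈` -/

/-- The quaternion unit `j`. -/
def quatJ : Quaternion ℝ := ⟨0, 0, 1, 0⟩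

theorem re_quatJ : quatJ.re = 0 := rfl

theorem imI_quatJ : quatJ.imI = 0 := rfl

theorem imJ_quatJ : quatJ.imJ = 1 := rfl

theorem imK_quatJ : quatJ.imK = 0 := rfl

theorem quatJ_mul_quatJ : quatJ * quatJ = -1 := by
  ext <;> simp [re_quatJ, imI_quatJ, imJ_quatJ, imK_quatJ] <;> rfl

theorem ofComplex_mul_quatJ (z : ℂ) :
    Quaternion.ofComplex z * quatJ = quatJ * Quaternion.ofComplex (starRingEnd ℂ z) := by
  ext <;> simp [re_quatJ, imI_quatJ, imJ_quatJ, imK_quatJ]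

theorem normSq_ofComplex_add_quatJ_mul (z w : ℂ) :
    Quaternion.normSq (Quaternion.ofComplex z + quatJ * Quaternion.ofComplex w) =
      Complex.normSq z + Complex.normSq w := by
  simp [Quaternion.normSq_def', re_quatJ, imI_quatJ, imJ_quatJ, imK_quatJ, Complex.normSq_apply]
  ring

theorem conj_eq_pow_thirteen {μ : ℂ} (hμ : IsPrimitiveRoot μ 14) :
    starRingEnd ℂ μ = μ ^ 13 := by
  have h : μ * μ ^ 13 = 1 := by rw [← pow_succ', hμ.pow_eq_one]
  rw [← Complex.inv_eq_conj (hμ.norm'_eq_one (by norm_num)), inv_eq_of_mul_eq_one_right h]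

theorem IsPrimitiveRoot.pow_seven_eq_neg_one {R : Type*} [CommRing R] [IsDomain R] {μ : R}
    (hμ : IsPrimitiveRoot μ 14) : μ ^ 7 = -1 :=
  (hμ.pow (by norm_num) (by norm_num : 14 = 7 * 2)).eq_neg_one_of_two_right

/-- The representation of `ℤQ₂₈` on the Hamilton quaternions in which `x` acts as a primitive
fourteenth root of unity and `y` acts as `j`. -/
noncomputable def quatRep (μ : ℂ) (hμ : IsPrimitiveRoot μ 14) : QR 7 →ₐ[ℤ] Quaternion ℝ :=
  quaternionRingHom (Quaternion.ofComplex μ) quatJ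
    (by rw [← map_pow, hμ.pow_eq_one, map_one])
    (by rw [← map_pow, hμ.pow_seven_eq_neg_one, map_neg, map_one, quatJ_mul_quatJ])
    (by rw [ofComplex_mul_quatJ, conj_eq_pow_thirteen hμ, map_pow])

theorem quatRep_Xq (μ : ℂ) (hμ : IsPrimitiveRoot μ 14) :
    quatRep μ hμ (Xq 7) = Quaternion.ofComplex μ :=
  quaternionRingHom_Xq _ _ _

theorem quatRep_aeval (μ : ℂ) (hμ : IsPrimitiveRoot μ 14) (A : Polynomial ℤ) :
    quatRep μ hμ (Polynomial.aeval (Xq 7) A) =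
      Quaternion.ofComplex (Polynomial.aeval μ A) := by
  rw [← Polynomial.aeval_algHom_apply, quatRep_Xq]
  exact Polynomial.aeval_algHom_apply (Quaternion.ofComplex.restrictScalars ℤ) μ A

theorem normSq_quatRep (μ : ℂ) (hμ : IsPrimitiveRoot μ 14) (A B : Polynomial ℤ) :
    Quaternion.normSq (quatRep μ hμ
      (Polynomial.aeval (Xq 7) A + Yq 7 * Polynomial.aeval (Xq 7) B)) =
      Complex.normSq (Polynomial.aeval μ A) + Complex.normSq (Polynomial.aeval μ B) := by
  rw [map_add, map_mul, quatRep_aeval, quatRep_aeval, ← normSq_ofComplex_add_quatJ_mul]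
  congr 3
  exact quaternionRingHom_Yq _ _ _

/-- The representation of `ℤQ₂₈` on the Gaussian integers with `x ↦ -1` and `y ↦ i`. -/
noncomputable def gaussRep : QR 7 →ₐ[ℤ] GaussianInt :=
  quaternionRingHom (-1) ⟨0, 1⟩ (by norm_num) (by ext <;> norm_num) (by ext <;> norm_num)

theorem gaussRep_Xq : gaussRep (Xq 7) = -1 := quaternionRingHom_Xq _ _ _

theorem gaussRep_Yq : gaussRep (Yq 7) = ⟨0, 1⟩ := quaternionRingHom_Yq _ _ _

theorem gaussRep_aeval (A : Polynomial ℤ) :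
    gaussRep (Polynomial.aeval (Xq 7) A) = (A.eval (-1) : ℤ) := by
  rw [← Polynomial.aeval_algHom_apply, gaussRep_Xq]
  have h := Polynomial.aeval_algebraMap_apply GaussianInt (-1 : ℤ) A
  simpa using h

theorem gaussRep_aeval_add (A B : Polynomial ℤ) :
    gaussRep (Polynomial.aeval (Xq 7) A + Yq 7 * Polynomial.aeval (Xq 7) B) =
      ⟨A.eval (-1), B.eval (-1)⟩ := by
  rw [map_add, map_mul, gaussRep_aeval, gaussRep_aeval, gaussRep_Yq]
  ext <;> simp

/-! ### Norms from the fourteenth cyclotomic field -/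

/-- The fourteenth cyclotomic field. -/
abbrev K14 : Type := CyclotomicField 14 ℚ

instance : IsCyclotomicExtension {14} ℚ K14 :=
  haveI : NeZero ((14 : ℕ) : ℚ) := ⟨by norm_num⟩
  CyclotomicField.isCyclotomicExtension 14 ℚ

/-- A primitive fourteenth root of unity in the cyclotomic field. -/
noncomputable def zeta14 : K14 := IsCyclotomicExtension.zeta 14 ℚ K14

theorem zeta14_spec : IsPrimitiveRoot zeta14 14 := IsCyclotomicExtension.zeta_spec 14 ℚ K14

theorem embedding_zeta14_spec (σ : K14 →ₐ[ℚ] ℂ) : IsPrimitiveRoot (σ zeta14) 14 :=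
  zeta14_spec.map_of_injective σ.injective

theorem cyclotomic_fourteen_eval_neg_one : (Polynomial.cyclotomic 14 ℤ).eval (-1) = 7 := by
  have h : Polynomial.cyclotomic 14 ℤ * (.X + 1) = .X ^ 7 + 1 := by
    have h1 := Polynomial.cyclotomic_expand_eq_cyclotomic_mul (p := 7) (n := 2)
      (by norm_num) (by norm_num) ℤ
    simpa [Polynomial.cyclotomic_two] using h1.symm
  have h2 : (.X + 1 : Polynomial ℤ) ≠ 0 := Polynomial.X_add_C_ne_zero 1
  have h3 : Polynomial.cyclotomic 14 ℤ =
      .X ^ 6 - .X ^ 5 + .X ^ 4 - .X ^ 3 + .X ^ 2 - .X + 1 := by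
    refine mul_right_cancel₀ h2 (h.trans ?_)
    ring
  simp [h3]

theorem seven_dvd_eval_of_aeval_zeta14_eq_zero {A : Polynomial ℤ}
    (h : Polynomial.aeval zeta14 A = 0) : (7 : ℤ) ∣ A.eval (-1) := by
  have h1 : Polynomial.cyclotomic 14 ℤ ∣ A := by
    rw [Polynomial.cyclotomic_eq_minpoly zeta14_spec (by norm_num)]
    exact minpoly.isIntegrallyClosed_dvd (zeta14_spec.isIntegral (by norm_num)) h
  obtain ⟨B, rfl⟩ := h1
  rw [Polynomial.eval_mul, cyclotomic_fourteen_eval_neg_one]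
  exact dvd_mul_right _ _

theorem one_le_prod_normSq {A : Polynomial ℤ} (h : Polynomial.aeval zeta14 A ≠ 0) :
    1 ≤ ∏ σ : K14 →ₐ[ℚ] ℂ, Complex.normSq (Polynomial.aeval (σ zeta14) A) := by
  set α := Polynomial.aeval zeta14 A with hα
  have hint : IsIntegral ℤ α := by
    rw [hα]
    exact IsIntegral.of_mem_of_fg _ (zeta14_spec.isIntegral (by norm_num)).fg_adjoin_singleton _
      (Polynomial.aeval_mem_adjoin_singleton ℤ zeta14)
  obtain ⟨n, hn⟩ := IsIntegrallyClosed.isIntegral_iff.mp (Algebra.isIntegral_norm ℚ hint)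
  have hn0 : n ≠ 0 := by
    rintro rfl
    rw [map_zero] at hn
    exact h (Algebra.norm_eq_zero_iff.mp hn.symm)
  have hprod : ∏ σ : K14 →ₐ[ℚ] ℂ, Polynomial.aeval (σ zeta14) A = (n : ℂ) := by
    have h1 := Algebra.norm_eq_prod_embeddings ℚ ℂ α
    rw [← hn] at h1
    have h2 : ∀ σ : K14 →ₐ[ℚ] ℂ, σ α = Polynomial.aeval (σ zeta14) A := fun σ =>
      (Polynomial.aeval_algHom_apply (σ.restrictScalars ℤ) zeta14 A).symm
    simp only [h2] at h1
    rw [← h1]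
    simp
  rw [← map_prod, hprod, Complex.normSq_intCast]
  have h3 : (1 : ℤ) ≤ n * n := by
    rcases lt_or_gt_of_ne hn0 with h | h <;> nlinarith
  exact_mod_cast h3

theorem prod_normSq_add_le (A B : Polynomial ℤ) :
    ∏ σ : K14 →ₐ[ℚ] ℂ, Complex.normSq (Polynomial.aeval (σ zeta14) A) +
        ∏ σ : K14 →ₐ[ℚ] ℂ, Complex.normSq (Polynomial.aeval (σ zeta14) B) ≤
      ∏ σ : K14 →ₐ[ℚ] ℂ, (Complex.normSq (Polynomial.aeval (σ zeta14) A) +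
        Complex.normSq (Polynomial.aeval (σ zeta14) B)) := by
  have hne : Nonempty (K14 →ₐ[ℚ] ℂ) := ⟨IsAlgClosed.lift⟩
  refine Finset.prod_add_prod_le (Finset.mem_univ hne.some) le_rfl ?_ ?_ ?_ ?_ <;>
    intros <;> simp [Complex.normSq_nonneg]

/-! ### Non-freeness of `P/NP` -/

theorem map_eq_zero_of_mem_NP {S : Type*} [Ring S] [Algebra ℤ S] (f : QR 7 →ₐ[ℤ] S)
    (hf : f Nelt = 0) {p : P28} (hp : p ∈ NP) : f p = 0 := by
  have h : Submodule.span (QR 7) ((fun w => Nelt * w) '' (P28 : Set (QR 7))) ≤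
      RingHom.ker f.toRingHom := by
    rw [Submodule.span_le]
    rintro _ ⟨w, -, rfl⟩
    change f (Nelt * w) = 0
    rw [map_mul, hf, zero_mul]
  exact h hp

theorem quatRep_Nelt (μ : ℂ) (hμ : IsPrimitiveRoot μ 14) : quatRep μ hμ Nelt = 0 := by
  refine map_Nelt_eq_zero _ ?_
  rw [quatRep_Xq, ← map_one Quaternion.ofComplex]
  exact fun h => hμ.ne_one (by norm_num) (Quaternion.ofComplex.toRingHom.injective h)

theorem gaussRep_Nelt : gaussRep Nelt = 0 := by
  refine map_Nelt_eq_zero _ ?_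
  rw [gaussRep_Xq]
  decide

theorem gaussRep_generator : gaussRep ((-3 : QR 7) + (4 : QR 7) * Yq 7) = ⟨-3, 4⟩ := by
  rw [map_add, map_mul, gaussRep_Yq, map_neg, map_ofNat, map_ofNat]
  ext <;> simp

theorem dvd_gaussRep_of_mem {w : QR 7} (hw : w ∈ P28) : (⟨-3, 4⟩ : GaussianInt) ∣ gaussRep w := by
  obtain ⟨r, s, rfl⟩ := Ideal.mem_span_pair.mp hw
  rw [map_add, map_mul, map_mul, gaussRep_generator, map_add, gaussRep_Xq, map_one]
  simp

theorem mem_P28_of_left (w : QR 7) : w * ((-3 : QR 7) + (4 : QR 7) * Yq 7) ∈ P28 :=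
  P28.mul_mem_left _ (Ideal.subset_span (by simp))

theorem mem_P28_of_right (w : QR 7) : w * (Xq 7 + 1) ∈ P28 :=
  P28.mul_mem_left _ (Ideal.subset_span (by simp))

theorem aeval_Xq_mem_P28 {A : Polynomial ℤ} (hA : A.eval (-1) = 0) :
    Polynomial.aeval (Xq 7) A ∈ P28 := by
  have h : Polynomial.X + 1 ∣ A := by
    have := Polynomial.dvd_iff_isRoot.mpr hA
    simpa using this
  obtain ⟨B, rfl⟩ := h
  rw [mul_comm, map_mul]
  simpa using mem_P28_of_right (Polynomial.aeval (Xq 7) B)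

/-- `P` contains an element congruent to `1` modulo the fourteenth cyclotomic polynomial in `x`. -/
theorem exists_mem_P28_quatRep_eq_one :
    ∃ p ∈ P28, ∀ (μ : ℂ) (hμ : IsPrimitiveRoot μ 14), quatRep μ hμ p = 1 := by
  refine ⟨1 + 7 * Polynomial.aeval (Xq 7) (Polynomial.cyclotomic 14 ℤ), ?_, fun μ hμ => ?_⟩
  · have h : 1 + 7 * Polynomial.aeval (Xq 7) (Polynomial.cyclotomic 14 ℤ) =
        (-6 - 8 * Yq 7) * ((-3 : QR 7) + (4 : QR 7) * Yq 7) +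
          Polynomial.aeval (Xq 7) (7 * Polynomial.cyclotomic 14 ℤ - 17 + 32 * .X ^ 7) := by
      have h1 : (-6 - 8 * Yq 7) * ((-3 : QR 7) + (4 : QR 7) * Yq 7) =
          18 - 32 * (Yq 7 * Yq 7) := by
        noncomm_ring
        norm_num [add_comm]
      rw [h1, Yq_mul_Yq]
      simp only [map_add, map_sub, map_mul, map_pow, Polynomial.aeval_X, map_ofNat]
      abel_nf
      norm_num [add_comm]
    rw [h]
    refine P28.add_mem (mem_P28_of_left _) (aeval_Xq_mem_P28 ?_)
    simp [cyclotomic_fourteen_eval_neg_one]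
  · have h : Polynomial.aeval μ (Polynomial.cyclotomic 14 ℤ) = 0 := by
      rw [Polynomial.cyclotomic_eq_minpoly hμ (by norm_num), minpoly.aeval]
    rw [map_add, map_mul, quatRep_aeval, h]
    simp

theorem gaussianInt_coord_ne_zero {g z : GaussianInt} (hz : z = g * ⟨-3, 4⟩)
    (hg : ∃ h, ⟨-3, 4⟩ = h * z) : ¬ (7 : ℤ) ∣ z.re ∧ ¬ (7 : ℤ) ∣ z.im := by
  obtain ⟨h, hh⟩ := hg
  have h1 := congrArg Zsqrtd.norm hh
  rw [hz, Zsqrtd.norm_mul, Zsqrtd.norm_mul] at h1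
  have h25 : Zsqrtd.norm (⟨-3, 4⟩ : GaussianInt) = 25 := by decide
  rw [h25] at h1
  have h2 : Zsqrtd.norm h * Zsqrtd.norm g = 1 := by linarith
  have h3 : Zsqrtd.norm g = 1 := by
    have hu : IsUnit (Zsqrtd.norm g) := IsUnit.of_mul_eq_one_right _ h2
    rcases Int.isUnit_iff.mp hu with h | h
    · exact h
    · have := GaussianInt.norm_nonneg g
      omega
  obtain ⟨a, b⟩ := g
  rw [Zsqrtd.norm_def] at h3
  have ha : -1 ≤ a ∧ a ≤ 1 := by constructor <;> nlinarith [mul_self_nonneg b]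
  have hb : -1 ≤ b ∧ b ≤ 1 := by constructor <;> nlinarith [mul_self_nonneg a]
  obtain ⟨ha1, ha2⟩ := ha
  obtain ⟨hb1, hb2⟩ := hb
  rw [hz]
  interval_cases a <;> interval_cases b <;> simp at h3 ⊢

theorem isEmpty_quotient_equiv :
    IsEmpty ((P28 ⧸ NP) ≃ₗ[QR 7] (QR 7 ⧸ Ideal.span {Nelt})) := by
  refine ⟨fun e => ?_⟩
  obtain ⟨w, hw⟩ := NP.mkQ_surjective (e.symm (Submodule.Quotient.mk 1))
  have hgen (p : P28) : ∃ r : QR 7, p - r • w ∈ NP := by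
    obtain ⟨r, hr⟩ := Submodule.Quotient.mk_surjective _ (e (NP.mkQ p))
    refine ⟨r, ?_⟩
    rw [← Submodule.Quotient.mk_eq_zero, Submodule.Quotient.mk_sub, Submodule.Quotient.mk_smul,
      sub_eq_zero]
    change NP.mkQ p = r • NP.mkQ w
    rw [hw, ← map_smul, LinearEquiv.eq_symm_apply, ← hr, ← Submodule.Quotient.mk_smul,
      smul_eq_mul, mul_one]
  have hmap {S : Type} [Ring S] [Algebra ℤ S] (f : QR 7 →ₐ[ℤ] S) (hf : f Nelt = 0) {p : P28}
      {r : QR 7} (h : p - r • w ∈ NP) : f p = f r * f w := by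
    have := map_eq_zero_of_mem_NP f hf h
    rwa [Submodule.coe_sub, Submodule.coe_smul, smul_eq_mul, map_sub, map_mul, sub_eq_zero] at this
  obtain ⟨A, B, hAB⟩ := exists_aeval_Xq (w : QR 7)
  have hcoord : ¬ (7 : ℤ) ∣ A.eval (-1) ∧ ¬ (7 : ℤ) ∣ B.eval (-1) := by
    obtain ⟨g, hg⟩ := dvd_gaussRep_of_mem w.2
    obtain ⟨r, hr⟩ := hgen ⟨(-3 : QR 7) + (4 : QR 7) * Yq 7, Ideal.subset_span (by simp)⟩
    have h1 := hmap gaussRep gaussRep_Nelt hr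
    rw [gaussRep_generator] at h1
    have h2 := gaussianInt_coord_ne_zero (hg.trans (mul_comm _ _)) ⟨_, h1⟩
    rwa [hAB, gaussRep_aeval_add] at h2
  obtain ⟨p, hp, hp1⟩ := exists_mem_P28_quatRep_eq_one
  obtain ⟨r, hr⟩ := hgen ⟨p, hp⟩
  obtain ⟨C, D, hCD⟩ := exists_aeval_Xq r
  have hunit (σ : K14 →ₐ[ℚ] ℂ) :
      (Complex.normSq (Polynomial.aeval (σ zeta14) C) +
        Complex.normSq (Polynomial.aeval (σ zeta14) D)) *
      (Complex.normSq (Polynomial.aeval (σ zeta14) A) +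
        Complex.normSq (Polynomial.aeval (σ zeta14) B)) = 1 := by
    have hσ := embedding_zeta14_spec σ
    have h1 := hmap (quatRep _ hσ) (quatRep_Nelt _ hσ) hr
    rw [hp1] at h1
    rw [← normSq_quatRep _ hσ, ← normSq_quatRep _ hσ, ← hAB, ← hCD, ← map_mul, ← h1, map_one]
  have hprod := Finset.prod_congr rfl
    fun σ (_ : σ ∈ (Finset.univ : Finset (K14 →ₐ[ℚ] ℂ))) => hunit σ
  rw [Finset.prod_mul_distrib, Finset.prod_const_one] at hprod
  have hA := one_le_prod_normSq fun h => hcoord.1 (seven_dvd_eval_of_aeval_zeta14_eq_zero h)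
  have hB := one_le_prod_normSq fun h => hcoord.2 (seven_dvd_eval_of_aeval_zeta14_eq_zero h)
  have hAB2 := prod_normSq_add_le A B
  have hnonneg (E : Polynomial ℤ) :
      0 ≤ ∏ σ : K14 →ₐ[ℚ] ℂ, Complex.normSq (Polynomial.aeval (σ zeta14) E) :=
    Finset.prod_nonneg fun _ _ => Complex.normSq_nonneg _
  have hCD2 : 1 ≤ ∏ σ : K14 →ₐ[ℚ] ℂ, (Complex.normSq (Polynomial.aeval (σ zeta14) C) +
      Complex.normSq (Polynomial.aeval (σ zeta14) D)) := by
    have hle := prod_normSq_add_le C D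
    by_cases hC : Polynomial.aeval zeta14 C = 0
    · by_cases hD : Polynomial.aeval zeta14 D = 0
      · have hne : K14 →ₐ[ℚ] ℂ := IsAlgClosed.lift
        have hzero {E : Polynomial ℤ} (h : Polynomial.aeval zeta14 E = 0) :
            Polynomial.aeval (hne zeta14) E = 0 := by
          rw [show Polynomial.aeval (hne zeta14) E = hne (Polynomial.aeval zeta14 E) from
            Polynomial.aeval_algHom_apply (hne.restrictScalars ℤ) zeta14 E, h, map_zero]
        have := hunit hne
        simp [hzero hC, hzero hD] at this
      · linarith [one_le_prod_normSq hD, hnonneg C]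
    · linarith [one_le_prod_normSq hC, hnonneg D]
  nlinarith

/-! ### An explicit isomorphism `ℤQ₂₈ ⊕ ℤQ₂₈ ≅ P ⊕ ℤQ₂₈` -/

/-- The cofactor `(X¹⁴ - 1) / (X + 1)`. -/
noncomputable def cofactorPoly : Polynomial ℤ :=
  .X ^ 13 - .X ^ 12 + .X ^ 11 - .X ^ 10 + .X ^ 9 - .X ^ 8 + .X ^ 7 - .X ^ 6 + .X ^ 5 - .X ^ 4 +
    .X ^ 3 - .X ^ 2 + .X - 1

/-- A polynomial whose value at `x` is invertible modulo `(x¹⁴ - 1) / (x + 1)`. -/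
noncomputable def unitPoly : Polynomial ℤ := .X ^ 12 - .X ^ 13 + 1 - .X + .X ^ 2

/-- An inverse of `unitPoly` modulo `(X¹⁴ - 1) / (X + 1)`. -/
noncomputable def unitInvPoly : Polynomial ℤ := .X ^ 2 * (1 - .X ^ 5 + .X ^ 10)

/-- The quotient of `1 - 4X⁷ - unitPoly` by `X + 1` modulo `X¹⁴ - 1` that vanishes at `-1`. -/
noncomputable def quotPoly : Polynomial ℤ :=
  .X - 2 * .X ^ 2 + 2 * .X ^ 3 - 2 * .X ^ 4 + 2 * .X ^ 5 - 2 * .X ^ 6 - 2 * .X ^ 7 + 2 * .X ^ 8 -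
    2 * .X ^ 9 + 2 * .X ^ 10 - 2 * .X ^ 11 + .X ^ 12

theorem aeval_Xq_eq_of_dvd {A B : Polynomial ℤ} (h : .X ^ 14 - 1 ∣ A - B) :
    Polynomial.aeval (Xq 7) A = Polynomial.aeval (Xq 7) B := by
  obtain ⟨C, hC⟩ := h
  rw [← sub_eq_zero, ← map_sub, hC, map_mul]
  simp [Xq_pow_fourteen]

theorem Yq_mul_Xq_pow {k l : ℕ} (h : k + l = 14) : Yq 7 * Xq 7 ^ k = Xq 7 ^ l * Yq 7 := by
  have h1 : ∀ m : ℕ, Xq 7 ^ m * Yq 7 * Xq 7 ^ m = Yq 7 := by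
    intro m
    induction m with
    | zero => simp
    | succ m ih =>
      calc Xq 7 ^ (m + 1) * Yq 7 * Xq 7 ^ (m + 1)
          = Xq 7 ^ m * Xq 7 * Yq 7 * (Xq 7 * Xq 7 ^ m) := by rw [← pow_succ, ← pow_succ']
        _ = Xq 7 ^ m * (Xq 7 * Yq 7 * Xq 7) * Xq 7 ^ m := by simp only [mul_assoc]
        _ = Yq 7 := by rw [Xq_mul_Yq_mul_Xq, ih]
  calc Yq 7 * Xq 7 ^ k = Xq 7 ^ (l + k) * Yq 7 * Xq 7 ^ k := by
        rw [add_comm, h, Xq_pow_fourteen, one_mul]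
    _ = Xq 7 ^ l * (Xq 7 ^ k * Yq 7 * Xq 7 ^ k) := by rw [pow_add]; simp only [mul_assoc]
    _ = Xq 7 ^ l * Yq 7 := by rw [h1]

namespace StablyFree

/-- `(x¹⁴ - 1) / (x + 1)` -/
noncomputable def phi : QR 7 := Polynomial.aeval (Xq 7) cofactorPoly
noncomputable def s : QR 7 := Polynomial.aeval (Xq 7) unitPoly
noncomputable def t : QR 7 := Polynomial.aeval (Xq 7) unitInvPoly
noncomputable def z : QR 7 := Polynomial.aeval (Xq 7) quotPoly

local notation "x" => Xq 7
local notation "y" => Yq 7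

theorem y_mul_phi : y * phi = phi * y := by
  have h (k l : ℕ) (h : k + l = 14) := Yq_mul_Xq_pow h
  have h1 : y * x = x ^ 13 * y := by simpa using h 1 13 rfl
  simp only [phi, cofactorPoly, map_add, map_sub, map_pow, Polynomial.aeval_X, map_one, mul_add,
    mul_sub, add_mul, sub_mul, h 13 1 rfl, h 12 2 rfl, h 11 3 rfl, h 10 4 rfl, h 9 5 rfl,
    h 8 6 rfl, h 7 7 rfl, h 6 8 rfl, h 5 9 rfl, h 4 10 rfl, h 3 11 rfl, h 2 12 rfl, h1, pow_one,
    mul_one, one_mul]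
  abel

theorem y_mul_z : y * z = x * z * y := by
  have h (k l : ℕ) (h : k + l = 14) := Yq_mul_Xq_pow h
  have h1 : y * x = x ^ 13 * y := by simpa using h 1 13 rfl
  have hy (w : QR 7) : y * (2 * w) = 2 * (y * w) := by rw [two_mul, two_mul, mul_add]
  have hx (w : QR 7) : x * (2 * w) = 2 * (x * w) := by rw [two_mul, two_mul, mul_add]
  simp only [z, quotPoly, map_add, map_sub, map_mul, map_pow, Polynomial.aeval_X, map_ofNat,
    mul_add, mul_sub, add_mul, sub_mul, hy, hx, h 12 2 rfl, h 11 3 rfl, h 10 4 rfl, h 9 5 rfl,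
    h 8 6 rfl, h 7 7 rfl, h 6 8 rfl, h 5 9 rfl, h 4 10 rfl, h 3 11 rfl, h 2 12 rfl, h1,
    ← pow_succ', Nat.reduceAdd, ← sq, mul_assoc]
  abel

theorem aeval_eq_add_mul (A : Polynomial ℤ) : ∃ B : Polynomial ℤ,
    Polynomial.aeval x A = ((A.eval (-1) : ℤ) : QR 7) + Polynomial.aeval x B * (x + 1) := by
  have h : Polynomial.X + 1 ∣ A - .C (A.eval (-1)) := by
    have : (A - .C (A.eval (-1))).IsRoot (-1) := by simp
    simpa using Polynomial.dvd_iff_isRoot.mpr this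
  obtain ⟨B, hB⟩ := h
  refine ⟨B, ?_⟩
  have h1 := congrArg (Polynomial.aeval x) (sub_eq_iff_eq_add'.mp hB)
  rw [mul_comm] at h1
  simpa using h1

theorem commute_aeval (A : Polynomial ℤ) : Commute x (Polynomial.aeval x A) := by
  have h : .X * A = A * .X := mul_comm _ _
  rw [commute_iff_eq]
  simpa using congrArg (Polynomial.aeval x) h

theorem phi_mul : phi * (x + 1) = 0 := by
  have h := aeval_Xq_eq_of_dvd (A := cofactorPoly * (.X + 1)) (B := 0)
    ⟨1, by rw [cofactorPoly]; ring⟩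
  simpa [phi] using h

theorem z_mul : z * (x + 1) = 1 - 4 * x ^ 7 - s := by
  have h := aeval_Xq_eq_of_dvd (A := quotPoly * (.X + 1)) (B := 1 - 4 * .X ^ 7 - unitPoly)
    ⟨0, by rw [quotPoly, unitPoly]; ring⟩
  simpa [z, s, map_ofNat (Polynomial.aeval x) 4] using h

theorem t_mul_s : t * s * (x + 1) = x + 1 := by
  have h := aeval_Xq_eq_of_dvd (A := unitInvPoly * unitPoly * (.X + 1)) (B := .X + 1)
    ⟨1 + .X - .X ^ 2 - .X ^ 5 + .X ^ 7 + .X ^ 10 - .X ^ 12, by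
      rw [unitInvPoly, unitPoly]; ring⟩
  simpa [t, s] using h

theorem exists_z_eq : ∃ B : Polynomial ℤ, z = Polynomial.aeval x B * (x + 1) := by
  obtain ⟨B, hB⟩ := aeval_eq_add_mul quotPoly
  exact ⟨B, by rw [z, hB]; simp [quotPoly]⟩

theorem exists_phi_eq : ∃ B : Polynomial ℤ, phi = -14 + Polynomial.aeval x B * (x + 1) := by
  obtain ⟨B, hB⟩ := aeval_eq_add_mul cofactorPoly
  exact ⟨B, by rw [phi, hB]; simp [cofactorPoly]⟩

theorem exists_s_eq : ∃ B : Polynomial ℤ, s = 5 + Polynomial.aeval x B * (x + 1) := by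
  obtain ⟨B, hB⟩ := aeval_eq_add_mul unitPoly
  exact ⟨B, by rw [s, hB]; simp [unitPoly]⟩

/-- `c = 1 + 2y`, a square root of `-3 + 4y` modulo `x + 1` -/
noncomputable def c : QR 7 := 1 + 2 * y
noncomputable def c' : QR 7 := 1 + 2 * (x * y)
noncomputable def cbar : QR 7 := 1 - 2 * y
noncomputable def d : QR 7 := 1 - 2 * (x * y)
noncomputable def beta : QR 7 := x + 1 + phi

theorem x_add_one_mul_y : (x + 1) * y = x * y * (x + 1) := by
  rw [add_mul, mul_add, Xq_mul_Yq_mul_Xq, one_mul, mul_one, add_comm]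

theorem xy_mul_xy : x * y * (x * y) = x ^ 7 := by
  rw [← mul_assoc, Xq_mul_Yq_mul_Xq, Yq_mul_Yq]

theorem x_add_one_mul_c : (x + 1) * c = c' * (x + 1) := by
  have h : (x + 1) * c = (x + 1) + 2 * ((x + 1) * y) := by rw [c]; noncomm_ring
  rw [h, x_add_one_mul_y, c']
  noncomm_ring

theorem cbar_mul_c : cbar * c = 1 - 4 * x ^ 7 := by
  rw [← Yq_mul_Yq, c, cbar]; noncomm_ring

theorem c_mul_cbar : c * cbar = 1 - 4 * x ^ 7 := by
  rw [← Yq_mul_Yq, c, cbar]; noncomm_ring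

theorem c'_mul_d : c' * d = 1 - 4 * x ^ 7 := by
  rw [← xy_mul_xy, c', d]; noncomm_ring

theorem d_mul_c' : d * c' = 1 - 4 * x ^ 7 := by
  rw [← xy_mul_xy, c', d]; noncomm_ring

theorem commute_x_pow_seven (w : QR 7) : Commute (x ^ 7) w := by
  obtain ⟨A, B, rfl⟩ := exists_aeval_Xq w
  refine .add_right ((commute_aeval A).pow_left 7) (.mul_right ?_ ((commute_aeval B).pow_left 7))
  exact (Yq_mul_Xq_pow (k := 7) (l := 7) rfl).symm

theorem commute_phi (w : QR 7) : Commute phi w := by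
  obtain ⟨A, B, rfl⟩ := exists_aeval_Xq w
  have h (C : Polynomial ℤ) : Commute phi (Polynomial.aeval x C) := by
    have h : cofactorPoly * C = C * cofactorPoly := mul_comm _ _
    rw [commute_iff_eq]
    simpa [phi] using congrArg (Polynomial.aeval x) h
  exact .add_right (h A) (.mul_right y_mul_phi.symm (h B))

theorem z_mul_phi : z * phi = 0 := by
  obtain ⟨B, hB⟩ := exists_z_eq
  rw [hB, mul_assoc, ← (commute_phi (x + 1)).eq, phi_mul, mul_zero]

theorem z_mul_beta : z * beta = 1 - 4 * x ^ 7 - s := by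
  rw [beta, mul_add, z_mul_phi, add_zero, z_mul]

theorem z_mul_d : z * d = cbar * z := by
  have h : z * (x * y) = y * z := by
    rw [y_mul_z, ← mul_assoc, z, (commute_aeval quotPoly).eq]
  calc z * d = z - 2 * (z * (x * y)) := by rw [d]; noncomm_ring
    _ = cbar * z := by rw [h, cbar]; noncomm_ring

theorem eq_zero_of_mul_norm_eq_zero {w : QR 7} (h : w * (1 - 4 * x ^ 7) = 0) : w = 0 := by
  have h1 : (1 - 4 * x ^ 7) * (1 + 4 * x ^ 7) = (-15 : ℤ) • (1 : QR 7) := by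
    have : (1 - 4 * x ^ 7) * (1 + 4 * x ^ 7) = 1 - 16 * x ^ 14 := by noncomm_ring
    rw [this, Xq_pow_fourteen]
    norm_num
  refine QR_smul_eq_zero (n := -15) (by norm_num) ?_
  rw [← mul_one w, ← mul_smul_comm, ← h1, ← mul_assoc, h, zero_mul]

theorem eq_zero_of_mul_s_eq_zero {w : QR 7} (h : w * s = 0) : w = 0 := by
  have hcomm : t * s = s * t := by
    have h : unitInvPoly * unitPoly = unitPoly * unitInvPoly := mul_comm _ _
    simpa [t, s] using congrArg (Polynomial.aeval x) h
  have h1 : w * (x + 1) = 0 := by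
    rw [← t_mul_s, hcomm, ← mul_assoc, ← mul_assoc, h, zero_mul, zero_mul]
  obtain ⟨B, hB⟩ := exists_s_eq
  have h2 : Polynomial.aeval x B * (x + 1) = (x + 1) * Polynomial.aeval x B :=
    ((commute_aeval B).add_left (.one_left _)).eq.symm
  rw [hB, h2, mul_add, ← mul_assoc, h1, zero_mul, add_zero] at h
  refine QR_smul_eq_zero (n := 5) (by norm_num) ?_
  rw [← h, zsmul_eq_mul, Int.cast_comm]
  norm_num

/-- The generator `-3 + 4y` of `P`. -/
noncomputable def u : QR 7 := (-3 : QR 7) + (4 : QR 7) * y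

theorem d_sub_beta_mul_c_mem : d - beta * c ∈ P28 := by
  obtain ⟨B, hB⟩ := exists_phi_eq
  have h1 : beta * c = c' * (x + 1) + c * phi := by
    rw [beta, add_mul, x_add_one_mul_c, (commute_phi c).eq]
  have h : d - beta * c = 3 * cbar * u + Polynomial.aeval x (24 * (1 + .X ^ 7) : Polynomial ℤ) -
      (2 * (x * y) + c' + c * Polynomial.aeval x B) * (x + 1) := by
    have h2 : d + 14 * c = 3 * cbar * u + 24 * (1 + x ^ 7) - 2 * (x * y * (x + 1)) := by
      rw [← x_add_one_mul_y, ← Yq_mul_Yq, d, c, cbar, u]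
      noncomm_ring
    rw [h1, hB]
    simp only [map_mul, map_add, map_one, map_pow, Polynomial.aeval_X, map_ofNat]
    rw [eq_sub_of_add_eq h2]
    noncomm_ring
  rw [h]
  exact P28.sub_mem (P28.add_mem (mem_P28_of_left _) (aeval_Xq_mem_P28 (by simp)))
    (mem_P28_of_right _)

theorem z_sub_c_mul_c_mem : z - c * c ∈ P28 := by
  have h : z - c * c = -1 * u + Polynomial.aeval x (quotPoly - 4 * 1 - 4 * .X ^ 7) := by
    simp only [map_mul, map_sub, map_one, map_pow, Polynomial.aeval_X, map_ofNat]
    rw [← Yq_mul_Yq, ← z, c, u]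
    noncomm_ring
  rw [h]
  exact P28.add_mem (mem_P28_of_left _) (aeval_Xq_mem_P28 (by simp [quotPoly]))

/-- Right multiplication by the matrix with rows `(beta, d)` and `(c, z)`, followed by the shear
`(q, e) ↦ (e - q * c, q)`; it maps `ℤQ₂₈ ⊕ ℤQ₂₈` onto `P ⊕ ℤQ₂₈`. -/
noncomputable def toProd : (QR 7 × QR 7) →ₗ[QR 7] (P28 × QR 7) :=
  ((LinearMap.toSpanSingleton (QR 7) P28 ⟨_, d_sub_beta_mul_c_mem⟩).coprod
    (LinearMap.toSpanSingleton (QR 7) P28 ⟨_, z_sub_c_mul_c_mem⟩)).prod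
  ((LinearMap.toSpanSingleton (QR 7) (QR 7) beta).coprod
    (LinearMap.toSpanSingleton (QR 7) (QR 7) c))

theorem toProd_snd (w v : QR 7) : (toProd (w, v)).2 = w * beta + v * c := rfl

theorem toProd_fst (w v : QR 7) :
    ((toProd (w, v)).1 : QR 7) = w * d + v * z - (w * beta + v * c) * c := by
  change w * (d - beta * c) + v * (z - c * c) = _
  noncomm_ring

theorem toProd_injective : Function.Injective toProd := by
  rw [injective_iff_map_eq_zero]
  rintro ⟨w, v⟩ h
  have h1 : w * beta + v * c = 0 := by rw [← toProd_snd, h]; rfl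
  have h2 : w * d + v * z = 0 := by
    have := toProd_fst w v
    rw [h, h1, zero_mul, sub_zero] at this
    exact this.symm
  have hw : w * (1 - 4 * x ^ 7) = -(v * z * c') := by
    rw [← d_mul_c', ← mul_assoc, eq_neg_of_add_eq_zero_left h2, neg_mul]
  have hcomm (r : QR 7) : r * (1 - 4 * x ^ 7) = (1 - 4 * x ^ 7) * r :=
    ((Commute.one_left r).sub_left
      ((Commute.ofNat_left 4 r).mul_left (commute_x_pow_seven r))).eq.symm
  have hzc : z * c' * beta = (1 - 4 * x ^ 7 - s) * c := by
    rw [beta, mul_add, mul_assoc z c' phi, ← (commute_phi c').eq, ← mul_assoc z phi, z_mul_phi,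
      zero_mul, add_zero, mul_assoc, ← x_add_one_mul_c, ← mul_assoc, z_mul]
  have hv : v * s * c = 0 := by
    have h3 : v * (c * (1 - 4 * x ^ 7)) = v * (z * c' * beta) := by
      rw [← mul_assoc, eq_neg_of_add_eq_zero_right h1, neg_mul, mul_assoc, hcomm, ← mul_assoc, hw]
      simp only [neg_mul, neg_neg, mul_assoc]
    rw [hzc, hcomm, sub_mul _ s, mul_sub, eq_comm, sub_eq_self, ← mul_assoc] at h3
    exact h3
  have hv0 : v = 0 := by
    refine eq_zero_of_mul_s_eq_zero (eq_zero_of_mul_norm_eq_zero ?_)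
    rw [← c_mul_cbar, ← mul_assoc, hv, zero_mul]
  subst hv0
  have hw0 : w = 0 := eq_zero_of_mul_norm_eq_zero (by simpa using hw)
  rw [hw0]
  rfl

/-- The left span of the rows `(beta, d)` and `(c, z)`. -/
noncomputable def rowSpan : Submodule (QR 7) (QR 7 × QR 7) :=
  Submodule.span (QR 7) {(beta, d), (c, z)}

theorem row_mem (w v : QR 7) : (w * beta + v * c, w * d + v * z) ∈ rowSpan :=
  Submodule.mem_span_pair.mpr ⟨w, v, rfl⟩

theorem commute_x_add_one_s : Commute (x + 1) s :=
  (commute_aeval unitPoly).add_left (.one_left _)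

theorem t_mul_x_add_one_mul_s : t * (x + 1) * s = x + 1 := by
  rw [mul_assoc, commute_x_add_one_s.eq, ← mul_assoc, t_mul_s]

theorem inr_x_add_one_mem : (0, x + 1) ∈ rowSpan := by
  have h := row_mem (t * (x + 1) * c') (-(t * (x + 1) * (x + 1)))
  have h1 : t * (x + 1) * c' * beta + -(t * (x + 1) * (x + 1)) * c = 0 := by
    rw [beta, neg_mul, mul_assoc _ (x + 1) c, x_add_one_mul_c, mul_add, ← mul_assoc _ c' (x + 1),
      add_right_comm, add_neg_cancel, zero_add, mul_assoc _ c' phi, ← (commute_phi c').eq,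
      mul_assoc t, ← mul_assoc (x + 1), ← (commute_phi (x + 1)).eq, phi_mul, zero_mul, mul_zero]
  have h2 : t * (x + 1) * c' * d + -(t * (x + 1) * (x + 1)) * z = x + 1 := by
    have hz : (x + 1) * z = 1 - 4 * x ^ 7 - s := by
      rw [← z_mul, z]
      exact ((commute_aeval quotPoly).add_left (.one_left _)).eq
    rw [neg_mul, mul_assoc _ c', c'_mul_d, mul_assoc _ (x + 1) z, hz, ← sub_eq_add_neg, ← mul_sub,
      sub_sub_cancel, t_mul_x_add_one_mul_s]
  rwa [h1, h2] at h

theorem inl_x_add_one_mem : (x + 1, 0) ∈ rowSpan := by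
  have h := row_mem (-(t * (x + 1) * z)) (t * (x + 1) * cbar)
  have h1 : -(t * (x + 1) * z) * beta + t * (x + 1) * cbar * c = x + 1 := by
    rw [neg_mul, mul_assoc _ z, z_mul_beta, mul_assoc _ cbar, cbar_mul_c, neg_add_eq_sub,
      ← mul_sub, sub_sub_cancel, t_mul_x_add_one_mul_s]
  have h2 : -(t * (x + 1) * z) * d + t * (x + 1) * cbar * z = 0 := by
    rw [neg_mul, mul_assoc _ z, z_mul_d, ← mul_assoc, neg_add_cancel]
  rwa [h1, h2] at h

/-- Membership in the row span only depends on coordinates modulo `x + 1`. -/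
theorem mem_rowSpan_of_sub {p q p' q' a b : QR 7} (h : (p, q) ∈ rowSpan)
    (hp : p = p' + a * (x + 1)) (hq : q = q' + b * (x + 1)) : (p', q') ∈ rowSpan := by
  have h1 := rowSpan.sub_mem (rowSpan.sub_mem h (rowSpan.smul_mem a inl_x_add_one_mem))
    (rowSpan.smul_mem b inr_x_add_one_mem)
  convert h1 using 1
  ext1 <;> simp [hp, hq]

theorem one_c_mem : (1, c) ∈ rowSpan := by
  obtain ⟨B, hB⟩ := exists_phi_eq
  obtain ⟨D, hD⟩ := exists_z_eq
  obtain ⟨E, hE⟩ := aeval_eq_add_mul (3 - 12 * .X ^ 7)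
  simp only [map_mul, map_sub, map_pow, Polynomial.aeval_X, map_ofNat] at hE
  refine mem_rowSpan_of_sub (row_mem 1 (3 * cbar))
    (a := 1 + Polynomial.aeval x B + Polynomial.aeval x E)
    (b := 3 * cbar * Polynomial.aeval x D - 2 * (x * y)) ?_ ?_
  · have h : 3 * (1 - 4 * x ^ 7) = 3 - 12 * x ^ 7 := by
      rw [mul_sub, ← mul_assoc]
      norm_num
    have hE15 : 3 - 12 * x ^ 7 = 15 + Polynomial.aeval x E * (x + 1) := by
      rw [hE]
      norm_num
    have h15 : (-14 : QR 7) + 15 = 1 := by norm_num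
    calc 1 * beta + 3 * cbar * c
        = (-14 + 15) + (1 + Polynomial.aeval x B + Polynomial.aeval x E) * (x + 1) := by
          rw [mul_assoc, cbar_mul_c, h, hE15, beta, hB]
          generalize (-14 : QR 7) = m, (15 : QR 7) = n
          noncomm_ring
      _ = _ := by rw [h15]
  · rw [hD, sub_mul _ _ (x + 1), mul_assoc 2 (x * y), ← x_add_one_mul_y, d, c]
    noncomm_ring

theorem zero_u_mem : (0, u) ∈ rowSpan := by
  obtain ⟨B, hB⟩ := exists_phi_eq
  obtain ⟨D, hD⟩ := exists_z_eq
  obtain ⟨E, hE⟩ := aeval_eq_add_mul (4 - 4 * .X ^ 6)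
  simp only [map_mul, map_sub, map_pow, Polynomial.aeval_X, map_ofNat] at hE
  have hyxy : y * x * y = x ^ 6 := by
    have h : y * x = x ^ 13 * y := by simpa using Yq_mul_Xq_pow (k := 1) (l := 13) rfl
    rw [h, mul_assoc, Yq_mul_Yq, ← pow_add, pow_eq_pow_of_zmod_eq Xq_pow_fourteen]
    rfl
  refine mem_rowSpan_of_sub (row_mem c 14)
    (a := c * (1 + Polynomial.aeval x B))
    (b := Polynomial.aeval x E - 2 * (x * y) + 14 * Polynomial.aeval x D) ?_ ?_
  · rw [beta, hB]
    noncomm_ring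
  · have h : c * d = 1 - 2 * (x * y) + 2 * y - 4 * (y * x * y) := by
      rw [c, d]
      noncomm_ring
    have h1 : Polynomial.aeval x E * (x + 1) = 4 - 4 * x ^ 6 := by
      rw [hE]
      simp
    rw [h, hyxy, hD, add_mul, sub_mul _ _ (x + 1), h1, mul_assoc 2 (x * y), ← x_add_one_mul_y, u]
    noncomm_ring
    norm_num
    abel

theorem toProd_surjective : Function.Surjective toProd := by
  have key {q e : QR 7} (h : (q, e) ∈ rowSpan) (he : e - q * c ∈ P28) :
      ((⟨e - q * c, he⟩ : P28), q) ∈ LinearMap.range toProd := by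
    obtain ⟨w, v, hwv⟩ := Submodule.mem_span_pair.mp h
    obtain ⟨rfl, rfl⟩ := Prod.ext_iff.mp hwv
    exact ⟨(w, v), Prod.ext (Subtype.ext (toProd_fst w v)) rfl⟩
  rw [← LinearMap.range_eq_top, eq_top_iff]
  rintro ⟨⟨p, hp⟩, q⟩ -
  obtain ⟨a, b, rfl⟩ := Ideal.mem_span_pair.mp hp
  have h : (q, a * u + b * (x + 1) + q * c) ∈ rowSpan := by
    have := rowSpan.add_mem (rowSpan.add_mem (rowSpan.smul_mem a zero_u_mem)
      (rowSpan.smul_mem b inr_x_add_one_mem)) (rowSpan.smul_mem q one_c_mem)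
    simpa using this
  have h1 := key h (by rwa [add_sub_cancel_right])
  simp only [add_sub_cancel_right] at h1
  exact h1

end StablyFree

theorem augQ_generator : augQ ((-3 : QR 7) + (4 : QR 7) * Yq 7) = 1 := by
  have h : augQ (Yq 7) = 1 := augQ_of _
  simp [h, map_ofNat augQ]

theorem Nelt_mem_P28 : Nelt ∈ P28 := by
  have h := mem_P28_of_left Nelt
  rwa [Nelt_mul, augQ_generator, one_smul] at h

theorem mem_NP_iff (w : P28) : w ∈ NP ↔ ∃ n : ℤ, (w : QR 7) = n • Nelt := by
  rw [NP, Submodule.mem_comap]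
  constructor
  · intro h
    have hle : Submodule.span (QR 7) ((fun w => Nelt * w) '' (P28 : Set (QR 7))) ≤
        Ideal.span {Nelt} := by
      rw [Submodule.span_le]
      rintro _ ⟨v, -, rfl⟩
      exact Ideal.mem_span_singleton'.mpr ⟨v, by simp only [Nelt_mul, mul_Nelt]⟩
    obtain ⟨r, hr⟩ := Ideal.mem_span_singleton'.mp (hle h)
    exact ⟨augQ r, by rw [← mul_Nelt, hr]; rfl⟩
  · rintro ⟨n, hn⟩
    refine Submodule.subset_span ⟨n • ((-3 : QR 7) + (4 : QR 7) * Yq 7), ?_, ?_⟩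
    · exact zsmul_mem (Ideal.subset_span (by simp)) n
    · simp only [Nelt_mul, map_zsmul, augQ_generator]
      simpa using hn.symm

theorem isUnit_of_zsmul_eq_Nelt {k : ℤ} {w : QR 7} (h : k • w = Nelt) : IsUnit k := by
  refine isUnit_of_dvd_one ⟨w.coeff 1, ?_⟩
  rw [← Nelt_apply_one, ← h]
  simp only [coeff_smul, Finsupp.coe_smul, Pi.smul_apply, smul_eq_mul]

/-- The automorphism of `M × M` given by an integral matrix with first row `(p, q)` and second row
`(-b, a)`. -/
def bezoutEquiv {R M : Type*} [Ring R] [AddCommGroup M] [Module R M] {a b p q : ℤ}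
    (h : p * a + q * b = 1) : (M × M) ≃ₗ[R] (M × M) where
  toFun v := (p • v.1 + q • v.2, -b • v.1 + a • v.2)
  invFun v := (a • v.1 - q • v.2, b • v.1 + p • v.2)
  map_add' v w := by ext <;> simp <;> abel
  map_smul' r v := by ext <;> simp [smul_comm r]
  left_inv v := by
    ext
    · calc _ = (p * a + q * b) • v.1 := by simp only; module
        _ = v.1 := by rw [h, one_smul]
    · calc _ = (p * a + q * b) • v.2 := by simp only; module
        _ = v.2 := by rw [h, one_smul]
  right_inv v := by
    ext
    · calc _ = (p * a + q * b) • v.1 := by simp only; module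
        _ = v.1 := by rw [h, one_smul]
    · calc _ = (p * a + q * b) • v.2 := by simp only; module
        _ = v.2 := by rw [h, one_smul]

/-- A stable isomorphism that carries the norm element to the norm element. -/
theorem exists_equiv_map_Nelt : ∃ e : (P28 × QR 7) ≃ₗ[QR 7] (QR 7 × QR 7),
    e (⟨Nelt, Nelt_mem_P28⟩, 0) = (Nelt, 0) := by
  let θ := LinearEquiv.ofBijective StablyFree.toProd
    ⟨StablyFree.toProd_injective, StablyFree.toProd_surjective⟩
  let v := θ.symm (⟨(-3 : QR 7) + (4 : QR 7) * Yq 7, Ideal.subset_span (by simp)⟩, 0)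
  have hv : θ.symm (⟨Nelt, Nelt_mem_P28⟩, 0) = (augQ v.1 • Nelt, augQ v.2 • Nelt) := by
    have h : ((⟨Nelt, Nelt_mem_P28⟩ : P28), (0 : QR 7)) =
        Nelt • (⟨(-3 : QR 7) + (4 : QR 7) * Yq 7, Ideal.subset_span (by simp)⟩, 0) := by
      refine Prod.ext (Subtype.ext ?_) (smul_zero _).symm
      change Nelt = Nelt * _
      rw [Nelt_mul, augQ_generator, one_smul]
    rw [h, map_smul, ← Nelt_mul, ← Nelt_mul]
    rfl
  have hcop : IsCoprime (augQ v.1) (augQ v.2) := by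
    rw [Int.isCoprime_iff_gcd_eq_one]
    obtain ⟨a, ha⟩ := Int.gcd_dvd_left (augQ v.1) (augQ v.2)
    obtain ⟨b, hb⟩ := Int.gcd_dvd_right (augQ v.1) (augQ v.2)
    set g := Int.gcd (augQ v.1) (augQ v.2)
    rw [ha, hb, mul_smul, mul_smul, ← Prod.smul_mk, LinearEquiv.symm_apply_eq, map_zsmul] at hv
    have h := isUnit_of_zsmul_eq_Nelt (k := g) (w := (θ (a • Nelt, b • Nelt)).1)
      (congrArg (fun m => (m.1 : QR 7)) hv).symm
    simpa using Int.isUnit_iff_natAbs_eq.mp h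
  obtain ⟨p, q, hpq⟩ := hcop
  refine ⟨θ.symm.trans (bezoutEquiv hpq), ?_⟩
  rw [LinearEquiv.trans_apply, hv]
  refine Prod.ext ?_ ?_
  · change p • augQ v.1 • Nelt + q • augQ v.2 • Nelt = Nelt
    rw [smul_smul, smul_smul, ← add_smul, hpq, one_smul]
  · change -augQ v.2 • augQ v.1 • Nelt + augQ v.1 • augQ v.2 • Nelt = 0
    rw [smul_smul, smul_smul, ← add_smul, neg_mul, mul_comm, neg_add_cancel, zero_smul]

theorem nonempty_prod_quotient_equiv :
    Nonempty (((P28 ⧸ NP) × QR 7) ≃ₗ[QR 7] ((QR 7 ⧸ Ideal.span {Nelt}) × QR 7)) := by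
  obtain ⟨e, he⟩ := exists_equiv_map_Nelt
  let f : (P28 × QR 7) →ₗ[QR 7] ((P28 ⧸ NP) × QR 7) := NP.mkQ.prodMap .id
  let g : (P28 × QR 7) →ₗ[QR 7] ((QR 7 ⧸ Ideal.span {Nelt}) × QR 7) :=
    ((Submodule.mkQ (Ideal.span {Nelt})).prodMap .id).comp e.toLinearMap
  have hf : Function.Surjective f := NP.mkQ_surjective.prodMap Function.surjective_id
  have hg : Function.Surjective g :=
    ((Submodule.mkQ_surjective _).prodMap Function.surjective_id).comp e.surjective
  have hen (n : ℤ) : e (n • (⟨Nelt, Nelt_mem_P28⟩, 0)) = (n • Nelt, 0) := by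
    rw [map_zsmul, he, Prod.smul_mk, smul_zero]
  have hfm (m : P28 × QR 7) : f m = 0 ↔ ∃ n : ℤ, m = n • (⟨Nelt, Nelt_mem_P28⟩, 0) := by
    obtain ⟨w, v⟩ := m
    have h : f (w, v) = 0 ↔ w ∈ NP ∧ v = 0 := by simp [f]
    rw [h, mem_NP_iff]
    simp [Prod.ext_iff, Subtype.ext_iff]
  have hgm (m : P28 × QR 7) : g m = 0 ↔ ∃ n : ℤ, m = n • (⟨Nelt, Nelt_mem_P28⟩, 0) := by
    have h : g m = 0 ↔ (e m).1 ∈ Ideal.span {Nelt} ∧ (e m).2 = 0 := by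
      simp [g, Prod.ext_iff]
    rw [h, Ideal.mem_span_singleton']
    simp only [← e.injective.eq_iff (a := m), hen, mul_Nelt]
    constructor
    · rintro ⟨⟨r, hr⟩, h2⟩
      exact ⟨augQ r, Prod.ext hr.symm h2⟩
    · rintro ⟨n, hn⟩
      rw [hn]
      exact ⟨⟨n, by simp⟩, rfl⟩
  have hker : f.ker = g.ker := by
    ext m
    rw [LinearMap.mem_ker, LinearMap.mem_ker, hfm, hgm]
  exact ⟨(f.quotKerEquivOfSurjective hf).symm.trans
    ((Submodule.quotEquivOfEq _ _ hker).trans (g.quotKerEquivOfSurjective hg))⟩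

/-- `P/NP` is not isomorphic to `ℤQ₂₈/⟨N⟩`, even though
`P/NP ⊕ ℤQ₂₈ ≅ ℤQ₂₈/⟨N⟩ ⊕ ℤQ₂₈`. -/
theorem stmt18 :
    IsEmpty ((P28 ⧸ NP) ≃ₗ[QR 7] (QR 7 ⧸ Ideal.span {Nelt})) ∧
    Nonempty (((P28 ⧸ NP) × QR 7) ≃ₗ[QR 7] ((QR 7 ⧸ Ideal.span {Nelt}) × QR 7)) :=
  ⟨isEmpty_quotient_equiv, nonempty_prod_quotient_equiv⟩
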